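/- (Estimate (yeta1), single-interval exponential decay in the proof of Theorem A(b)) Let u be a weak stationary solution density and let U be a Lyapunov function in 𝒰 with respect to ℒ with Lyapunov constant γ > 0, essential lower bound ρ_m and essential upper bound ρ_M. Let H be an upper sandwich function for U with H(t) > 0 for all t ∈ [ρ_m, ρ_M), and assume condition (R): for Lebesgue-a.e. ρ ∈ [ρ_m, ρ_M), ∇U(x) ≠ 0 for every x ∈ U^{-1}(ρ). If ρ_m ≤ η̃ ≤ η < ρ_M and every ρ ∈ (η̃, η) satisfies ∇U(x) ≠ 0 for all x ∈ U^{-1}(ρ), then μ(𝒰 \ Ω_η) ≤ μ(𝒰 \ Ω_{η̃}) · exp(−γ ∫_{η̃}^{η} dt / H(t)). -/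

import Mathlib

open MeasureTheory

noncomputable section

/-- Euclidean space ℝⁿ. -/
abbrev Eucl (n : ℕ) : Type := EuclideanSpace ℝ (Fin n)

/-- First-order partial derivative `∂ᵢ f`. -/
def pd {n : ℕ} (f : Eucl n → ℝ) (i : Fin n) (x : Eucl n) : ℝ :=
  fderiv ℝ f x (EuclideanSpace.single i 1)

/-- Second-order partial derivative `∂²ᵢⱼ f`. -/
def pd2 {n : ℕ} (f : Eucl n → ℝ) (i j : Fin n) (x : Eucl n) : ℝ :=
  fderiv ℝ (fun y => fderiv ℝ f y (EuclideanSpace.single j 1)) x (EuclideanSpace.single i 1)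

/-- The adjoint Fokker–Planck operator `ℒf = aⁱʲ ∂²ᵢⱼ f + Vⁱ ∂ᵢ f`. -/
def Lop {n : ℕ} (a : Eucl n → Matrix (Fin n) (Fin n) ℝ)
    (V : Eucl n → Fin n → ℝ) (f : Eucl n → ℝ) (x : Eucl n) : ℝ :=
  (∑ i, ∑ j, a x i j * pd2 f i j x) + ∑ i, V x i * pd f i x

/-- The quadratic form `⟨a(x) ∇f(x), ∇f(x)⟩ = ∑ᵢⱼ aⁱʲ ∂ᵢf ∂ⱼf`. -/
def aQuad {n : ℕ} (a : Eucl n → Matrix (Fin n) (Fin n) ℝ)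
    (f : Eucl n → ℝ) (x : Eucl n) : ℝ :=
  ∑ i, ∑ j, a x i j * pd f i x * pd f j x

open scoped Convolution

/-- The mollification of `f` by a normalized bump function. -/
def mollify {n : ℕ} (φ : ContDiffBump (0 : Eucl n)) (f : Eucl n → ℝ) : Eucl n → ℝ :=
  φ.normed volume ⋆[ContinuousLinearMap.lsmul ℝ ℝ, volume] f

section Mollify

variable {n : ℕ}

lemma contDiff_mollify (φ : ContDiffBump (0 : Eucl n)) {f : Eucl n → ℝ} (hf : Continuous f) :
    ContDiff ℝ (⊤ : ℕ∞) (mollify φ f) :=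
  φ.hasCompactSupport_normed.contDiff_convolution_left _ φ.contDiff_normed hf.locallyIntegrable

lemma abs_mollify_le (φ : ContDiffBump (0 : Eucl n)) {f : Eucl n → ℝ} (hf : Continuous f)
    {C : ℝ} (hC : ∀ x, |f x| ≤ C) (x : Eucl n) : |mollify φ f x| ≤ C := by
  have h := dist_convolution_le (μ := volume) (x₀ := x) (z₀ := (0 : ℝ))
    ((abs_nonneg _).trans (hC 0)) φ.support_normed_eq.subset φ.nonneg_normed φ.integral_normed
    hf.aestronglyMeasurable (fun y _ => by simpa using hC y)
  simpa [mollify] using h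

lemma tsupport_mollify_subset (φ : ContDiffBump (0 : Eucl n)) {f : Eucl n → ℝ} {δ : ℝ}
    (hδ : φ.rOut ≤ δ) : tsupport (mollify φ f) ⊆ Metric.cthickening δ (tsupport f) := by
  refine closure_minimal ?_ Metric.isClosed_cthickening
  intro x hx
  obtain ⟨y, hy, z, hz, rfl⟩ := Set.mem_add.1 (support_convolution_subset _ hx)
  rw [φ.support_normed_eq, mem_ball_zero_iff] at hy
  refine Metric.mem_cthickening_of_dist_le _ z _ _ (subset_tsupport _ hz) ?_
  simpa using hy.le.trans hδ

lemma continuous_pd {f : Eucl n → ℝ} (hf : ContDiff ℝ 1 f) (i : Fin n) : Continuous (pd f i) :=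
  (hf.continuous_fderiv one_ne_zero).clm_apply continuous_const

lemma contDiff_pd {f : Eucl n → ℝ} (hf : ContDiff ℝ 2 f) (i : Fin n) : ContDiff ℝ 1 (pd f i) :=
  (hf.fderiv_right (m := 1) (by norm_num)).clm_apply contDiff_const

lemma pd_eq_zero_of_notMem_tsupport {f : Eucl n → ℝ} {i : Fin n} {x : Eucl n}
    (hx : x ∉ tsupport f) : pd f i x = 0 := by
  simp [pd, fderiv_of_notMem_tsupport ℝ hx]

lemma tsupport_pd_subset (f : Eucl n → ℝ) (i : Fin n) : tsupport (pd f i) ⊆ tsupport f :=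
  closure_minimal (fun _ hx => by_contra fun h => hx (pd_eq_zero_of_notMem_tsupport h))
    (isClosed_tsupport f)

lemma hasCompactSupport_pd {f : Eucl n → ℝ} (hf : HasCompactSupport f) (i : Fin n) :
    HasCompactSupport (pd f i) :=
  hf.of_isClosed_subset (isClosed_tsupport _) (tsupport_pd_subset f i)

lemma pd2_eq_pd_pd (f : Eucl n → ℝ) (i j : Fin n) : pd2 f i j = pd (pd f j) i := rfl

lemma pd_mollify (φ : ContDiffBump (0 : Eucl n)) {f : Eucl n → ℝ} (hf : ContDiff ℝ 1 f)
    (hc : HasCompactSupport f) (i : Fin n) : pd (mollify φ f) i = mollify φ (pd f i) := by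
  have hφ : LocallyIntegrable (φ.normed (volume : Measure (Eucl n))) volume :=
    φ.continuous_normed.locallyIntegrable
  funext x
  have h := (hc.hasFDerivAt_convolution_right (ContinuousLinearMap.lsmul ℝ ℝ) hφ hf x).fderiv
  rw [pd, mollify, h, convolution_precompR_apply _ hφ (hc.fderiv ℝ)
    (hf.continuous_fderiv one_ne_zero)]
  rfl

lemma pd2_mollify (φ : ContDiffBump (0 : Eucl n)) {f : Eucl n → ℝ} (hf : ContDiff ℝ 2 f)
    (hc : HasCompactSupport f) (i j : Fin n) : pd2 (mollify φ f) i j = mollify φ (pd2 f i j) := by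
  rw [pd2_eq_pd_pd, pd2_eq_pd_pd, pd_mollify φ (hf.of_le (by norm_num)) hc,
    pd_mollify φ (contDiff_pd hf j) (hasCompactSupport_pd hc j)]

lemma Lop_eq_zero_of_notMem_tsupport {a : Eucl n → Matrix (Fin n) (Fin n) ℝ}
    {V : Eucl n → Fin n → ℝ} {f : Eucl n → ℝ} {x : Eucl n} (hx : x ∉ tsupport f) :
    Lop a V f x = 0 := by
  simp [Lop, pd2_eq_pd_pd, pd_eq_zero_of_notMem_tsupport hx,
    pd_eq_zero_of_notMem_tsupport (fun h => hx (tsupport_pd_subset f _ h))]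

lemma continuousOn_Lop {𝒰 : Set (Eucl n)} {a : Eucl n → Matrix (Fin n) (Fin n) ℝ}
    {V : Eucl n → Fin n → ℝ} (ha : ∀ i j, ContinuousOn (fun x => a x i j) 𝒰)
    (hV : ContinuousOn V 𝒰) {f : Eucl n → ℝ} (hf : ContDiff ℝ 2 f) :
    ContinuousOn (Lop a V f) 𝒰 := by
  have h1 : ∀ i, Continuous (pd f i) := continuous_pd (hf.of_le (by norm_num))
  have h2 : ∀ i j, Continuous (pd2 f i j) := fun i j => continuous_pd (contDiff_pd hf j) i
  refine .add (continuousOn_finsetSum _ fun i _ => continuousOn_finsetSum _ fun j _ =>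
    (ha i j).mul (h2 i j).continuousOn) (continuousOn_finsetSum _ fun i _ =>
    (continuousOn_pi.1 hV i).mul (h1 i).continuousOn)

/-- The stationarity identity extends from smooth to `C²` compactly supported test functions. -/
lemma integral_Lop_eq_zero_of_contDiff_two {𝒰 : Set (Eucl n)} (hUopen : IsOpen 𝒰)
    {a : Eucl n → Matrix (Fin n) (Fin n) ℝ} {V : Eucl n → Fin n → ℝ} {u : Eucl n → ℝ}
    (ha : ∀ i j, ContinuousOn (fun x => a x i j) 𝒰) (hV : ContinuousOn V 𝒰)
    (hu : ContinuousOn u 𝒰)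
    (hu_stat : ∀ f : Eucl n → ℝ, ContDiff ℝ (⊤ : ℕ∞) f → HasCompactSupport f →
      tsupport f ⊆ 𝒰 → (∫ x in 𝒰, Lop a V f x * u x) = 0)
    {f : Eucl n → ℝ} (hf : ContDiff ℝ 2 f) (hc : HasCompactSupport f) (hsub : tsupport f ⊆ 𝒰) :
    (∫ x in 𝒰, Lop a V f x * u x) = 0 := by
  obtain ⟨δ, hδ, hK⟩ := hc.isCompact.exists_cthickening_subset_open hUopen hsub
  set K := Metric.cthickening δ (tsupport f)
  have hKc : IsCompact K := hc.isCompact.cthickening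
  have h1 : ∀ i, Continuous (pd f i) := continuous_pd (hf.of_le (by norm_num))
  have h2 : ∀ i j, Continuous (pd2 f i j) := fun i j => continuous_pd (contDiff_pd hf j) i
  have hb1 : ∀ i, ∃ C, ∀ x, |pd f i x| ≤ C := fun i =>
    (hasCompactSupport_pd hc i).exists_bound_of_continuous (h1 i)
  have hb2 : ∀ i j, ∃ C, ∀ x, |pd2 f i j x| ≤ C := fun i j =>
    (hasCompactSupport_pd (hasCompactSupport_pd hc j) i).exists_bound_of_continuous (h2 i j)
  choose C1 hC1 using hb1
  choose C2 hC2 using hb2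
  let φ : ℕ → ContDiffBump (0 : Eucl n) := fun k =>
    { rIn := δ / (k + 1) / 2
      rOut := δ / (k + 1)
      rIn_pos := by positivity
      rIn_lt_rOut := half_lt_self (by positivity) }
  have hφδ : ∀ k, (φ k).rOut ≤ δ := fun k => div_le_self hδ.le (by simp)
  have hφ0 : Filter.Tendsto (fun k => (φ k).rOut) Filter.atTop (nhds 0) := by
    simpa [φ, div_eq_mul_inv] using
      (tendsto_one_div_add_atTop_nhds_zero_nat (𝕜 := ℝ)).const_mul δ
  have hsupp : ∀ k, tsupport (mollify (φ k) f) ⊆ K := fun k =>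
    tsupport_mollify_subset (φ k) (hφδ k)
  have hsm : ∀ k, ContDiff ℝ (⊤ : ℕ∞) (mollify (φ k) f) := fun k =>
    contDiff_mollify (φ k) hf.continuous
  have hzero : ∀ k, (∫ x in 𝒰, Lop a V (mollify (φ k) f) x * u x) = 0 := fun k =>
    hu_stat _ (hsm k) (hKc.of_isClosed_subset (isClosed_tsupport _) (hsupp k))
      ((hsupp k).trans hK)
  let M : Eucl n → ℝ := fun x =>
    ((∑ i, ∑ j, |a x i j| * C2 i j) + ∑ i, |V x i| * C1 i) * |u x|
  have hM : ContinuousOn M 𝒰 :=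
    ContinuousOn.mul (.add (continuousOn_finsetSum _ fun i _ => continuousOn_finsetSum _ fun j _ =>
      (ha i j).abs.mul continuousOn_const) (continuousOn_finsetSum _ fun i _ =>
      (continuousOn_pi.1 hV i).abs.mul continuousOn_const)) hu.abs
  have hlim : Filter.Tendsto (fun k => ∫ x in 𝒰, Lop a V (mollify (φ k) f) x * u x) Filter.atTop
      (nhds (∫ x in 𝒰, Lop a V f x * u x)) := by
    refine tendsto_integral_of_dominated_convergence (K.indicator M) (fun k => ?_) ?_
      (fun k => ?_) ?_
    · exact ((continuousOn_Lop ha hV (contDiff_infty.1 (hsm k) 2)).mul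
        hu).aestronglyMeasurable hUopen.measurableSet
    · exact ((integrable_indicator_iff hKc.isClosed.measurableSet).2
        ((hM.mono hK).integrableOn_compact hKc)).restrict
    · refine Filter.Eventually.of_forall fun x => ?_
      by_cases hx : x ∈ K
      · rw [Set.indicator_of_mem hx, norm_mul, Real.norm_eq_abs, Real.norm_eq_abs]
        refine mul_le_mul_of_nonneg_right ?_ (abs_nonneg _)
        refine (abs_add_le _ _).trans (add_le_add ?_ ?_)
        · refine (Finset.abs_sum_le_sum_abs _ _).trans (Finset.sum_le_sum fun i _ => ?_)
          refine (Finset.abs_sum_le_sum_abs _ _).trans (Finset.sum_le_sum fun j _ => ?_)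
          rw [abs_mul, pd2_mollify _ hf hc]
          exact mul_le_mul_of_nonneg_left (abs_mollify_le _ (h2 i j) (hC2 i j) x) (abs_nonneg _)
        · refine (Finset.abs_sum_le_sum_abs _ _).trans (Finset.sum_le_sum fun i _ => ?_)
          rw [abs_mul, pd_mollify _ (hf.of_le (by norm_num)) hc]
          exact mul_le_mul_of_nonneg_left (abs_mollify_le _ (h1 i) (hC1 i) x) (abs_nonneg _)
      · rw [Set.indicator_of_notMem hx,
          Lop_eq_zero_of_notMem_tsupport fun h => hx (hsupp k h)]
        simp
    · refine Filter.Eventually.of_forall fun x => Filter.Tendsto.mul_const _ ?_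
      refine Filter.Tendsto.add (tendsto_finsetSum _ fun i _ => tendsto_finsetSum _ fun j _ =>
        Filter.Tendsto.const_mul _ ?_) (tendsto_finsetSum _ fun i _ =>
        Filter.Tendsto.const_mul _ ?_)
      · simp_rw [pd2_mollify _ hf hc]
        exact ContDiffBump.convolution_tendsto_right_of_continuous hφ0 (h2 i j) x
      · simp_rw [pd_mollify _ (hf.of_le (by norm_num : (1 : WithTop ℕ∞) ≤ 2)) hc]
        exact ContDiffBump.convolution_tendsto_right_of_continuous hφ0 (h1 i) x
  simp_rw [hzero] at hlim
  exact tendsto_nhds_unique hlim tendsto_const_nhds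

end Mollify

section Line

open Set

/-- A discrete Grönwall argument for a monotone quantity without any regularity. -/
lemma mul_exp_integral_le_of_mul_one_add_le {G w : ℝ → ℝ} {a b : ℝ} (hab : a ≤ b)
    (hGanti : AntitoneOn G (Icc a b))
    (hw : IntervalIntegrable w volume a b) (hw0 : 0 ≤ ∫ x in a..b, w x)
    (h : ∀ s ∈ Icc a b, ∀ t ∈ Icc a b, s < t → G t * (1 + ∫ x in s..t, w x) ≤ G s) :
    G b * Real.exp (∫ x in a..b, w x) ≤ G a := by
  set W := ∫ x in a..b, w x with hW
  have hwI : ∀ s ∈ Icc a b, ∀ t ∈ Icc a b, IntervalIntegrable w volume s t := fun s hs t ht =>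
    hw.mono_set (by rw [uIcc_of_le hab]; exact uIcc_subset_Icc hs ht)
  have haI : a ∈ Icc a b := left_mem_Icc.2 hab
  have hbI : b ∈ Icc a b := right_mem_Icc.2 hab
  have hcont : ContinuousOn (fun t => ∫ x in a..t, w x) (Icc a b) := by
    have := intervalIntegral.continuousOn_primitive_interval' hw left_mem_uIcc
    rwa [uIcc_of_le hab] at this
  have key : ∀ d : ℝ, 0 ≤ d → ∀ k : ℕ, ∀ t ∈ Icc a b, (∫ x in a..t, w x) = k * d →
      G t * (1 + d) ^ k ≤ G a := by
    intro d hd k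
    induction k with
    | zero => intro t ht _; simpa using hGanti haI ht ht.1
    | succ k ih =>
      intro t ht hkt
      obtain ⟨s, hs, hks⟩ : (k * d : ℝ) ∈ (fun t => ∫ x in a..t, w x) '' Icc a t := by
        refine intermediate_value_Icc ht.1 (hcont.mono (Icc_subset_Icc_right ht.2)) ⟨?_, ?_⟩
        · simp only [intervalIntegral.integral_same]; positivity
        · simp only [hkt]; push_cast; nlinarith
      have hsI : s ∈ Icc a b := ⟨hs.1, hs.2.trans ht.2⟩
      have hst : (∫ x in s..t, w x) = d := by
        have := intervalIntegral.integral_add_adjacent_intervals (hwI a haI s hsI) (hwI s hsI t ht)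
        simp only at hks
        rw [hks, hkt] at this
        push_cast at this
        linarith
      have hstep : G t * (1 + d) ≤ G s := by
        rcases hs.2.eq_or_lt with rfl | hlt
        · have : d = 0 := by rw [← hst, intervalIntegral.integral_same]
          simp [this]
        · simpa [hst] using h s hsI t ht hlt
      calc G t * (1 + d) ^ (k + 1) = (G t * (1 + d)) * (1 + d) ^ k := by ring
        _ ≤ G s * (1 + d) ^ k := by gcongr
        _ ≤ G a := ih s hsI hks
  have hlim := (Real.tendsto_one_add_div_pow_exp W).const_mul (G b)
  refine le_of_tendsto hlim ?_
  filter_upwards [Filter.eventually_gt_atTop 0] with N hN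
  exact key (W / N) (by positivity) N b hbI (by field_simp; rfl)

/-- Comparison of measures on compact sets by continuous functions supported in an open set. -/
lemma measure_le_of_forall_lintegral_le {μ₁ μ₂ : Measure ℝ} [IsFiniteMeasure μ₁]
    [IsFiniteMeasure μ₂] {O : Set ℝ} (hO : IsOpen O)
    (h : ∀ ψ : ℝ → ℝ, Continuous ψ → (∀ x, 0 ≤ ψ x) → (∀ x, ψ x ≤ 1) →
      (∀ x ∉ O, ψ x = 0) → ∫⁻ x, ENNReal.ofReal (ψ x) ∂μ₂ ≤ ∫⁻ x, ENNReal.ofReal (ψ x) ∂μ₁) :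
    μ₂.restrict O ≤ μ₁.restrict O := by
  have hcpt : ∀ K, IsCompact K → K ⊆ O → μ₂ K ≤ μ₁ K := by
    intro K hK hKO
    rw [K.measure_eq_iInf_isOpen μ₁]
    refine le_iInf₂ fun A hKA => le_iInf fun hA => ?_
    obtain ⟨ψ, hψ1, hψ0, -, hψI⟩ := exists_continuous_one_zero_of_isCompact hK
      (hA.inter hO).isClosed_compl (disjoint_compl_right_iff_subset.2 (subset_inter hKA hKO))
    calc μ₂ K = ∫⁻ x, K.indicator 1 x ∂μ₂ := by
          rw [lintegral_indicator_one hK.measurableSet]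
      _ ≤ ∫⁻ x, ENNReal.ofReal (ψ x) ∂μ₂ := lintegral_mono fun x => by
          by_cases hx : x ∈ K
          · simp [hx, hψ1 hx]
          · simp [hx]
      _ ≤ ∫⁻ x, ENNReal.ofReal (ψ x) ∂μ₁ := h ψ ψ.continuous (fun x => (hψI x).1)
          (fun x => (hψI x).2) fun x hx => hψ0 fun hx' => hx hx'.2
      _ ≤ ∫⁻ x, A.indicator 1 x ∂μ₁ := lintegral_mono fun x => by
          by_cases hx : x ∈ A
          · simpa [hx] using (hψI x).2
          · have : ψ x = 0 := hψ0 fun hx' => hx hx'.1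
            simp [this]
      _ = μ₁ A := by rw [lintegral_indicator_one hA.measurableSet]
  refine Measure.le_iff.2 fun E hE => ?_
  rw [Measure.restrict_apply hE, Measure.restrict_apply hE,
    (hE.inter hO.measurableSet).measure_eq_iSup_isCompact]
  exact iSup₂_le fun K hKE => iSup_le fun hK =>
    (hcpt K hK (hKE.trans inter_subset_right)).trans (measure_mono hKE)

/-- A weighted comparison of Lebesgue measure with `ν`, tested on continuous functions,
can be divided by the positive weight. -/
lemma mul_integral_one_div_le_measureReal_Ioo {ν : Measure ℝ} [IsFiniteMeasure ν] {s t c B : ℝ}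
    (hst : s < t) (hc : 0 ≤ c) {H : ℝ → ℝ} (hH : Measurable H) (hpos : ∀ x ∈ Ioo s t, 0 < H x)
    (hB : ∀ x ∈ Ioo s t, H x ≤ B)
    (hint : IntervalIntegrable (fun x => 1 / H x) volume s t)
    (h : ∀ ψ : ℝ → ℝ, Continuous ψ → (∀ x, 0 ≤ ψ x) → (∀ x, ψ x ≤ 1) →
      (∀ x ∉ Ioo s t, ψ x = 0) → c * ∫ x, ψ x ≤ ∫ x, ψ x * H x ∂ν) :
    c * ∫ x in s..t, 1 / H x ≤ ν.real (Ioo s t) := by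
  have hOm : MeasurableSet (Ioo s t) := measurableSet_Ioo
  let μ₁ : Measure ℝ := (ν.restrict (Ioo s t)).withDensity fun x => ENNReal.ofReal (H x)
  let μ₂ : Measure ℝ := ENNReal.ofReal c • volume.restrict (Ioo s t)
  have hHm : Measurable fun x => ENNReal.ofReal (H x) := hH.ennreal_ofReal
  have : IsFiniteMeasure μ₁ := by
    refine isFiniteMeasure_withDensity (ne_of_lt ?_)
    calc ∫⁻ x in Ioo s t, ENNReal.ofReal (H x) ∂ν ≤ ∫⁻ _ in Ioo s t, ENNReal.ofReal B ∂ν :=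
          setLIntegral_mono measurable_const fun x hx => ENNReal.ofReal_le_ofReal (hB x hx)
      _ < ⊤ := by
          rw [setLIntegral_const]
          exact ENNReal.mul_lt_top ENNReal.ofReal_lt_top (measure_lt_top _ _)
  have : IsFiniteMeasure (volume.restrict (Ioo s t)) := ⟨by simp⟩
  have : IsFiniteMeasure μ₂ := Measure.smul_finite _ ENNReal.ofReal_ne_top
  have hle : μ₂.restrict (Ioo s t) ≤ μ₁.restrict (Ioo s t) := by
    refine measure_le_of_forall_lintegral_le isOpen_Ioo fun ψ hψ hψ0 hψ1 hψs => ?_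
    have hψc : HasCompactSupport ψ := HasCompactSupport.intro (K := Icc s t) isCompact_Icc
      fun x hx => hψs x fun hx' => hx (Ioo_subset_Icc_self hx')
    have e2 : ∫⁻ x, ENNReal.ofReal (ψ x) ∂μ₂ = ENNReal.ofReal (c * ∫ x, ψ x) := by
      rw [lintegral_smul_measure, smul_eq_mul, ENNReal.ofReal_mul hc,
        ofReal_integral_eq_lintegral_ofReal (hψ.integrable_of_hasCompactSupport hψc)
          (Filter.Eventually.of_forall hψ0), ← lintegral_indicator hOm]
      congr 2
      funext x
      by_cases hx : x ∈ Ioo s t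
      · rw [indicator_of_mem hx]
      · rw [indicator_of_notMem hx, hψs x hx, ENNReal.ofReal_zero]
    have hψH0 : ∀ x, 0 ≤ ψ x * H x := fun x => by
      by_cases hx : x ∈ Ioo s t
      · exact mul_nonneg (hψ0 x) (hpos x hx).le
      · simp [hψs x hx]
    have hψHi : Integrable (fun x => ψ x * H x) ν := by
      refine Integrable.of_bound (hψ.measurable.mul hH).aestronglyMeasurable (max B 0)
        (Filter.Eventually.of_forall fun x => ?_)
      rw [Real.norm_of_nonneg (hψH0 x)]
      by_cases hx : x ∈ Ioo s t
      · exact (mul_le_of_le_one_left (hpos x hx).le (hψ1 x)).trans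
          ((hB x hx).trans (le_max_left _ _))
      · simp [hψs x hx]
    have e1 : ∫⁻ x, ENNReal.ofReal (ψ x) ∂μ₁ = ENNReal.ofReal (∫ x, ψ x * H x ∂ν) := by
      rw [lintegral_withDensity_eq_lintegral_mul _ hHm hψ.measurable.ennreal_ofReal,
        ofReal_integral_eq_lintegral_ofReal hψHi (Filter.Eventually.of_forall hψH0),
        ← lintegral_indicator hOm]
      congr 1
      funext x
      by_cases hx : x ∈ Ioo s t
      · rw [indicator_of_mem hx, Pi.mul_apply, mul_comm, ENNReal.ofReal_mul (hψ0 x)]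
      · rw [indicator_of_notMem hx, hψs x hx, zero_mul, ENNReal.ofReal_zero]
    rw [e1, e2]
    exact ENNReal.ofReal_le_ofReal (h ψ hψ hψ0 hψ1 hψs)
  have hinv := lintegral_mono' hle (le_refl fun x => ENNReal.ofReal (1 / H x))
  have hmeas : Measurable fun x => ENNReal.ofReal (1 / H x) :=
    (measurable_const.div hH).ennreal_ofReal
  have hi : IntegrableOn (fun x => 1 / H x) (Ioo s t) volume :=
    ((intervalIntegrable_iff_integrableOn_Ioc_of_le hst.le).1 hint).mono_set Ioo_subset_Ioc_self
  have l2 : ∫⁻ x in Ioo s t, ENNReal.ofReal (1 / H x) ∂μ₂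
      = ENNReal.ofReal (c * ∫ x in s..t, 1 / H x) := by
    rw [Measure.restrict_smul, Measure.restrict_restrict hOm, inter_self, lintegral_smul_measure,
      smul_eq_mul, ENNReal.ofReal_mul hc, intervalIntegral.integral_of_le hst.le,
      integral_Ioc_eq_integral_Ioo, ofReal_integral_eq_lintegral_ofReal hi]
    exact (ae_restrict_iff' hOm).2 (Filter.Eventually.of_forall fun x hx =>
      (one_div_pos.2 (hpos x hx)).le)
  have l1 : ∫⁻ x in Ioo s t, ENNReal.ofReal (1 / H x) ∂μ₁ = ν (Ioo s t) := by
    rw [restrict_withDensity hOm, Measure.restrict_restrict hOm, inter_self,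
      lintegral_withDensity_eq_lintegral_mul _ hHm hmeas]
    calc ∫⁻ x in Ioo s t, ((fun x => ENNReal.ofReal (H x)) * fun x => ENNReal.ofReal (1 / H x)) x ∂ν
        = ∫⁻ _ in Ioo s t, 1 ∂ν := setLIntegral_congr_fun hOm fun x hx => by
          have hx' := hpos x hx
          rw [Pi.mul_apply, ← ENNReal.ofReal_mul hx'.le, mul_one_div_cancel hx'.ne',
            ENNReal.ofReal_one]
      _ = ν (Ioo s t) := setLIntegral_one _
  rw [l1, l2] at hinv
  exact (ENNReal.ofReal_le_iff_le_toReal (measure_ne_top _ _)).1 hinv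

end Line

section TestFunction

open Set

/-- A test function `F` on the line with first derivative `Φ ≥ 0` and second derivative `g ≤ ψ`,
where `Φ` equals `∫ ψ` on `[t, r]` and `F` vanishes to the right of `[t, r]`. -/
lemma exists_test_function {ψ : ℝ → ℝ} {s t r r' : ℝ} (hst : s < t) (htr : t ≤ r) (hrr' : r < r')
    (hψ : Continuous ψ) (hψ0 : ∀ x, 0 ≤ ψ x) (hψs : ∀ x ∉ Ioo s t, ψ x = 0) :
    ∃ F Φ g : ℝ → ℝ, (∀ x, HasDerivAt F (Φ x) x) ∧ (∀ x, HasDerivAt Φ (g x) x) ∧ Continuous g ∧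
      (∀ x, r' ≤ x → F x = 0) ∧ (∀ x, 0 ≤ Φ x) ∧ (∀ x ≤ s, Φ x = 0) ∧
      (∀ x ∈ Icc t r, Φ x = ∫ y, ψ y) ∧ ∀ x, g x ≤ ψ x := by
  let bump : ContDiffBump ((r + r') / 2) :=
    { rIn := (r' - r) / 4
      rOut := (r' - r) / 2
      rIn_pos := by linarith
      rIn_lt_rOut := by linarith }
  set τ : ℝ → ℝ := bump.normed volume with hτ
  have hτc : Continuous τ := bump.continuous_normed
  have hτ0 : ∀ x, 0 ≤ τ x := bump.nonneg_normed
  have hτi : Integrable τ := bump.integrable_normed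
  have hτ1 : ∫ x, τ x = 1 := bump.integral_normed
  have hτsupp : Function.support τ = Ioo r r' := by
    rw [hτ, bump.support_normed_eq, Real.ball_eq_Ioo]
    congr 1 <;> simp only [bump] <;> ring
  have hτs : ∀ x ∉ Ioo r r', τ x = 0 := fun x hx => by
    rw [← hτsupp] at hx; exact Function.notMem_support.1 hx
  set I := ∫ y, ψ y with hI
  have hI0 : 0 ≤ I := integral_nonneg hψ0
  have hIτ : Continuous fun x => I * τ x := continuous_const.mul hτc
  have hgc : Continuous fun x => ψ x - I * τ x := hψ.sub hIτ
  set Φ : ℝ → ℝ := fun x => ∫ y in s..x, (ψ y - I * τ y) with hΦ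
  have hΦd : ∀ x, HasDerivAt Φ (ψ x - I * τ x) x := fun x =>
    hgc.integral_hasStrictDerivAt s x |>.hasDerivAt
  have hΦc : Continuous Φ := continuous_iff_continuousAt.2 fun x => (hΦd x).continuousAt
  have hsplit : ∀ x, Φ x = (∫ y in s..x, ψ y) - I * ∫ y in s..x, τ y := fun x => by
    rw [← intervalIntegral.integral_const_mul, ← intervalIntegral.integral_sub
      (hψ.intervalIntegrable _ _) (hIτ.intervalIntegrable _ _)]
  have hA : ∀ x, t ≤ x → ∫ y in s..x, ψ y = I := fun x hx =>
    intervalIntegral.integral_eq_integral_of_support_subset fun y hy =>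
      have hy' : y ∈ Ioo s t := by_contra fun h => hy (hψs y h)
      ⟨hy'.1, hy'.2.le.trans hx⟩
  have hT0 : ∀ x ≤ r, ∫ y in s..x, τ y = 0 := fun x hx =>
    (intervalIntegral.integral_congr (g := fun _ => 0) fun y hy => hτs y fun hy' =>
      absurd (hy.2.trans (max_le (hst.le.trans htr) hx)) (not_le.2 hy'.1)).trans
      intervalIntegral.integral_zero
  have hT1 : ∀ x, r' ≤ x → ∫ y in s..x, τ y = 1 := fun x hx => by
    rw [intervalIntegral.integral_eq_integral_of_support_subset, hτ1]
    rw [hτsupp]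
    exact fun y hy => ⟨(hst.trans_le htr).trans hy.1, hy.2.le.trans hx⟩
  have hTle : ∀ x, s ≤ x → ∫ y in s..x, τ y ≤ 1 := fun x hx => by
    rw [intervalIntegral.integral_of_le hx, ← hτ1]
    exact setIntegral_le_integral hτi (Filter.Eventually.of_forall hτ0)
  have hΦs : ∀ x ≤ s, Φ x = 0 := fun x hx =>
    (intervalIntegral.integral_congr (g := fun _ => 0) fun y hy => by
      have hys : y ≤ s := hy.2.trans (max_le le_rfl hx)
      simp only
      rw [hψs y fun h => absurd h.1 (not_lt.2 hys),
        hτs y fun h => absurd h.1 (not_lt.2 (hys.trans (hst.le.trans htr)))]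
      ring).trans intervalIntegral.integral_zero
  have hΦr' : ∀ x, r' ≤ x → Φ x = 0 := fun x hx => by
    rw [hsplit, hA x (htr.trans (hrr'.le.trans hx)), hT1 x hx]; ring
  refine ⟨fun x => ∫ y in r'..x, Φ y, Φ, fun x => ψ x - I * τ x,
    fun x => (hΦc.integral_hasStrictDerivAt r' x).hasDerivAt, hΦd, hgc, ?_, ?_, hΦs, ?_, ?_⟩
  · exact fun x hx => (intervalIntegral.integral_congr (g := fun _ => 0) fun y hy =>
      hΦr' y ((le_min le_rfl hx).trans hy.1)).trans intervalIntegral.integral_zero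
  · intro x
    rcases le_total x s with hx | hx
    · exact (hΦs x hx).ge
    rw [hsplit]
    rcases le_total x r with hxr | hxr
    · rw [hT0 x hxr, mul_zero, sub_zero]
      exact intervalIntegral.integral_nonneg hx fun y _ => hψ0 y
    · rw [hA x (htr.trans hxr)]
      nlinarith [hTle x hx]
  · intro x hx
    rw [hsplit, hA x hx.1, hT0 x hx.2]; ring
  · intro x
    have := mul_nonneg hI0 (hτ0 x)
    simp only
    linarith

end TestFunction

section ChainRule

variable {n : ℕ} {𝒰 : Set (Eucl n)} {U f : Eucl n → ℝ} {F Φ g : ℝ → ℝ}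

lemma pd_comp {x : Eucl n} (hF : HasDerivAt F (Φ (U x)) (U x)) (hU : DifferentiableAt ℝ U x)
    (i : Fin n) : pd (F ∘ U) i x = Φ (U x) * pd U i x := by
  rw [pd, (hF.comp_hasFDerivAt x hU.hasFDerivAt).fderiv]
  rfl

lemma pd_congr {f g : Eucl n → ℝ} {x : Eucl n} (h : f =ᶠ[nhds x] g) (i : Fin n) :
    pd f i x = pd g i x := by
  rw [pd, pd, h.fderiv_eq]

lemma pd_mul {f g : Eucl n → ℝ} {x : Eucl n} (hf : DifferentiableAt ℝ f x)
    (hg : DifferentiableAt ℝ g x) (i : Fin n) :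
    pd (fun y => f y * g y) i x = f x * pd g i x + pd f i x * g x := by
  simp only [pd]
  rw [fderiv_fun_mul hf hg]
  simp [mul_comm]

lemma Lop_of_eqOn_comp {a : Eucl n → Matrix (Fin n) (Fin n) ℝ} {V : Eucl n → Fin n → ℝ}
    (hUopen : IsOpen 𝒰) (hU : ContDiffOn ℝ 2 U 𝒰) (hf : Set.EqOn f (F ∘ U) 𝒰)
    (hF : ∀ y, HasDerivAt F (Φ y) y) (hΦ : ∀ y, HasDerivAt Φ (g y) y) {x : Eucl n} (hx : x ∈ 𝒰) :
    Lop a V f x = Φ (U x) * Lop a V U x + g (U x) * aQuad a U x := by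
  have hUd : ∀ y ∈ 𝒰, DifferentiableAt ℝ U y := fun y hy =>
    (hU.contDiffAt (hUopen.mem_nhds hy)).differentiableAt (by norm_num)
  have h1 : ∀ i, ∀ y ∈ 𝒰, pd f i y = Φ (U y) * pd U i y := fun i y hy => by
    rw [pd_congr (hf.eventuallyEq_of_mem (hUopen.mem_nhds hy)), pd_comp (hF _) (hUd y hy)]
  have hpd : ∀ j, DifferentiableAt ℝ (pd U j) x := fun j =>
    (((hU.contDiffAt (hUopen.mem_nhds hx)).fderiv_right (m := 1) (by norm_num)).differentiableAt
      one_ne_zero).clm_apply (differentiableAt_const _)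
  have h2 : ∀ i j, pd2 f i j x = Φ (U x) * pd2 U i j x + g (U x) * (pd U i x * pd U j x) := by
    intro i j
    have he : pd f j =ᶠ[nhds x] fun y => (Φ ∘ U) y * pd U j y :=
      Filter.eventuallyEq_of_mem (hUopen.mem_nhds hx) (h1 j)
    rw [pd2_eq_pd_pd, pd_congr he,
      pd_mul ((hΦ (U x)).differentiableAt.comp x (hUd x hx)) (hpd j), pd_comp (hΦ _) (hUd x hx),
      pd2_eq_pd_pd]
    simp only [Function.comp]
    ring
  simp only [Lop, aQuad, h1 _ x hx, h2, Finset.mul_sum, mul_add, Finset.sum_add_distrib]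
  have e1 : ∀ i j, a x i j * (Φ (U x) * pd2 U i j x) = Φ (U x) * (a x i j * pd2 U i j x) :=
    fun i j => by ring
  have e2 : ∀ i j, a x i j * (g (U x) * (pd U i x * pd U j x))
      = g (U x) * (a x i j * pd U i x * pd U j x) := fun i j => by ring
  have e3 : ∀ i, V x i * (Φ (U x) * pd U i x) = Φ (U x) * (V x i * pd U i x) := fun i => by ring
  simp only [e1, e2, e3]
  ring

/-- A `C²` function of `U` that vanishes for large values of `U`, extended by zero. -/
lemma contDiff_indicator_comp {K : Set (Eucl n)} (hUopen : IsOpen 𝒰) (hU : ContDiffOn ℝ 2 U 𝒰)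
    (hF : ContDiff ℝ 2 F) (hK : IsClosed K) (h0 : ∀ x ∈ 𝒰, x ∉ K → F (U x) = 0)
    (hK𝒰 : K ⊆ 𝒰) : ContDiff ℝ 2 (𝒰.indicator (F ∘ U)) := by
  refine contDiff_iff_contDiffAt.2 fun x => ?_
  by_cases hx : x ∈ K
  · have hmem := hUopen.mem_nhds (hK𝒰 hx)
    exact (hF.contDiffAt.comp x (hU.contDiffAt hmem)).congr_of_eventuallyEq
      (Filter.eventuallyEq_of_mem hmem (Set.eqOn_indicator))
  · refine (contDiffAt_const (c := (0 : ℝ))).congr_of_eventuallyEq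
      (Filter.eventuallyEq_of_mem (hK.isOpen_compl.mem_nhds hx) fun y hy => ?_)
    by_cases hy𝒰 : y ∈ 𝒰
    · simp [hy𝒰, h0 y hy𝒰 hy]
    · simp [hy𝒰]

lemma contDiff_two_of_hasDerivAt (hF : ∀ y, HasDerivAt F (Φ y) y)
    (hΦ : ∀ y, HasDerivAt Φ (g y) y) (hg : Continuous g) : ContDiff ℝ 2 F := by
  have e1 : deriv Φ = g := funext fun y => (hΦ y).deriv
  have e2 : deriv F = Φ := funext fun y => (hF y).deriv
  have h1 : ContDiff ℝ 1 Φ := contDiff_one_iff_deriv.2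
    ⟨fun y => (hΦ y).differentiableAt, e1 ▸ hg⟩
  exact (contDiff_succ_iff_deriv (n := 1)).2
    ⟨fun y => (hF y).differentiableAt, by simp, e2 ▸ h1⟩

end ChainRule

section Decay

open Set

variable {n : ℕ} {𝒰 : Set (Eucl n)} {a : Eucl n → Matrix (Fin n) (Fin n) ℝ}
  {V : Eucl n → Fin n → ℝ} {u U : Eucl n → ℝ}

lemma measurableSet_sep_preimage (h𝒰 : MeasurableSet 𝒰) (hU : ContinuousOn U 𝒰) {E : Set ℝ}
    (hE : MeasurableSet E) : MeasurableSet {x ∈ 𝒰 | U x ∈ E} := by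
  have h : {x ∈ 𝒰 | U x ∈ E} = Subtype.val '' (𝒰.domRestrict U ⁻¹' E) := by
    ext x
    exact ⟨fun h => ⟨⟨x, h.1⟩, h.2, rfl⟩, by rintro ⟨y, hy, rfl⟩; exact ⟨y.2, hy⟩⟩
  rw [h]
  exact h𝒰.subtype_image (hU.domRestrict.measurable hE)

/-- The law of `U` under the measure with density `u` on `𝒰`. -/
def lawOf (𝒰 : Set (Eucl n)) (u U : Eucl n → ℝ) : Measure ℝ :=
  ((volume.restrict 𝒰).withDensity fun x => ENNReal.ofReal (u x)).map U

lemma integral_lawOf (h𝒰 : MeasurableSet 𝒰) (hU : ContinuousOn U 𝒰) (hu : ContinuousOn u 𝒰)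
    (hu_nonneg : ∀ x ∈ 𝒰, 0 ≤ u x) {k : ℝ → ℝ} (hk : Measurable k) :
    ∫ y, k y ∂lawOf 𝒰 u U = ∫ x in 𝒰, k (U x) * u x := by
  have hum : AEMeasurable (fun x => ENNReal.ofReal (u x)) (volume.restrict 𝒰) :=
    (hu.aemeasurable h𝒰).ennreal_ofReal
  rw [lawOf, integral_map ((hU.aemeasurable h𝒰).mono_ac (withDensity_absolutelyContinuous _ _))
    hk.aestronglyMeasurable, integral_withDensity_eq_integral_toReal_smul₀ hum (by simp)]
  refine setIntegral_congr_fun h𝒰 fun x hx => ?_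
  simp [ENNReal.toReal_ofReal (hu_nonneg x hx), mul_comm]

lemma measureReal_lawOf (h𝒰 : MeasurableSet 𝒰) (hU : ContinuousOn U 𝒰) (hu : ContinuousOn u 𝒰)
    (hu_nonneg : ∀ x ∈ 𝒰, 0 ≤ u x) {E : Set ℝ} (hE : MeasurableSet E) :
    (lawOf 𝒰 u U).real E = ∫ x in {x ∈ 𝒰 | U x ∈ E}, u x := by
  rw [← integral_indicator_one hE,
    integral_lawOf h𝒰 hU hu hu_nonneg (k := E.indicator 1) (measurable_one.indicator hE),
    ← inter_eq_self_of_subset_right (sep_subset 𝒰 fun x => U x ∈ E),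
    ← setIntegral_indicator (measurableSet_sep_preimage h𝒰 hU hE)]
  refine setIntegral_congr_fun h𝒰 fun x hx => ?_
  by_cases h : U x ∈ E
  · simp [h, hx]
  · simp [h]

lemma isFiniteMeasure_lawOf (hu_int : IntegrableOn u 𝒰) : IsFiniteMeasure (lawOf 𝒰 u U) := by
  have := isFiniteMeasure_withDensity_ofReal hu_int.hasFiniteIntegral
  exact Measure.isFiniteMeasure_map _ _

/-- Testing stationarity against functions of `U` bounds the mass of `{t ≤ U ≤ r}`. -/
lemma mul_integral_mul_mass_le (hUopen : IsOpen 𝒰)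
    (ha : ∀ i j, ContinuousOn (fun x => a x i j) 𝒰)
    (ha_psd : ∀ x ∈ 𝒰, ∀ v : Fin n → ℝ, 0 ≤ ∑ i, ∑ j, a x i j * v i * v j)
    (hV : ContinuousOn V 𝒰) (hu : ContinuousOn u 𝒰) (hu_nonneg : ∀ x ∈ 𝒰, 0 ≤ u x)
    (hu_int : IntegrableOn u 𝒰)
    (hu_stat : ∀ f : Eucl n → ℝ, ContDiff ℝ (⊤ : ℕ∞) f → HasCompactSupport f →
      tsupport f ⊆ 𝒰 → (∫ x in 𝒰, Lop a V f x * u x) = 0)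
    (hU_C2 : ContDiffOn ℝ 2 U 𝒰) {γ s t r r' B : ℝ} (hst : s < t) (htr : t ≤ r) (hrr' : r < r')
    (hK : IsCompact {x ∈ 𝒰 | U x ≤ r'}) (hγ : 0 ≤ γ)
    (hLyap : ∀ x ∈ 𝒰, s < U x → Lop a V U x ≤ -γ)
    {H : ℝ → ℝ} (hH : Measurable H) (hH_nonneg : ∀ y ∈ Ioo s t, 0 ≤ H y)
    (hH_le : ∀ y ∈ Ioo s t, H y ≤ B) (hH_up : ∀ x ∈ 𝒰, aQuad a U x ≤ H (U x))
    {ψ : ℝ → ℝ} (hψ : Continuous ψ) (hψ0 : ∀ x, 0 ≤ ψ x) (hψ1 : ∀ x, ψ x ≤ 1)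
    (hψs : ∀ x ∉ Ioo s t, ψ x = 0) :
    γ * (∫ x in {x ∈ 𝒰 | U x ∈ Icc t r}, u x) * ∫ y, ψ y ≤
      ∫ x in 𝒰, ψ (U x) * H (U x) * u x := by
  obtain ⟨F, Φ, g, hF, hΦ, hg, hF0, hΦ0, hΦs, hΦI, hgψ⟩ :=
    exists_test_function hst htr hrr' hψ hψ0 hψs
  set I := ∫ y, ψ y
  set K := {x ∈ 𝒰 | U x ≤ r'}
  set f := 𝒰.indicator (F ∘ U) with hf
  have hKU : K ⊆ 𝒰 := sep_subset _ _
  have hFK : ∀ x ∈ 𝒰, x ∉ K → F (U x) = 0 := fun x hx hxK =>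
    hF0 _ (not_le.1 fun h => hxK ⟨hx, h⟩).le
  have hfC : ContDiff ℝ 2 f := contDiff_indicator_comp hUopen hU_C2
    (contDiff_two_of_hasDerivAt hF hΦ hg) hK.isClosed hFK hKU
  have hfK : tsupport f ⊆ K := closure_minimal (fun x hx => by
    by_contra hxK
    refine hx ?_
    by_cases hx𝒰 : x ∈ 𝒰
    · rw [hf, indicator_of_mem hx𝒰]; exact hFK x hx𝒰 hxK
    · rw [hf, indicator_of_notMem hx𝒰]) hK.isClosed
  have hfc : HasCompactSupport f := hK.of_isClosed_subset (isClosed_tsupport _) hfK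
  have hzero := integral_Lop_eq_zero_of_contDiff_two hUopen ha hV hu hu_stat hfC hfc
    (hfK.trans hKU)
  have hU𝒰 : MeasurableSet 𝒰 := hUopen.measurableSet
  have hLi : IntegrableOn (fun x => Lop a V f x * u x) 𝒰 := by
    refine IntegrableOn.of_forall_sdiff_eq_zero (s := K)
      ((((continuousOn_Lop ha hV hfC).mul hu).mono hKU).integrableOn_compact hK)
      hU𝒰 fun x hx => ?_
    rw [Lop_eq_zero_of_notMem_tsupport fun h => hx.2 (hfK h), zero_mul]
  have hUm : AEMeasurable U (volume.restrict 𝒰) := hU_C2.continuousOn.aemeasurable hU𝒰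
  have hψHi : IntegrableOn (fun x => ψ (U x) * H (U x) * u x) 𝒰 := by
    refine Integrable.bdd_mul (c := max B 0) hu_int
      ((hψ.measurable.mul hH).comp_aemeasurable hUm).aestronglyMeasurable
      (Filter.Eventually.of_forall fun x => ?_)
    by_cases hx : U x ∈ Ioo s t
    · rw [Real.norm_of_nonneg (mul_nonneg (hψ0 _) (hH_nonneg _ hx))]
      exact (mul_le_of_le_one_left (hH_nonneg _ hx) (hψ1 _)).trans
        ((hH_le _ hx).trans (le_max_left _ _))
    · simp [hψs _ hx]
  set S := {x ∈ 𝒰 | U x ∈ Icc t r} with hS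
  have hSm : MeasurableSet S := measurableSet_sep_preimage hU𝒰 hU_C2.continuousOn measurableSet_Icc
  have hSi : IntegrableOn (S.indicator u) 𝒰 := hu_int.indicator hSm
  have hpt : ∀ x ∈ 𝒰, Lop a V f x * u x ≤
      ψ (U x) * H (U x) * u x - γ * I * S.indicator u x := by
    intro x hx
    have hL := Lop_of_eqOn_comp (a := a) (V := V) hUopen hU_C2 (f := f) eqOn_indicator hF hΦ hx
    have hq0 : 0 ≤ aQuad a U x := ha_psd x hx fun i => pd U i x
    have h1 : g (U x) * aQuad a U x ≤ ψ (U x) * H (U x) :=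
      (mul_le_mul_of_nonneg_right (hgψ _) hq0).trans
        (mul_le_mul_of_nonneg_left (hH_up x hx) (hψ0 _))
    have h2 : Φ (U x) * Lop a V U x ≤ -γ * Φ (U x) := by
      rcases le_or_gt (U x) s with h | h
      · simp [hΦs _ h]
      · nlinarith [hLyap x hx h, hΦ0 (U x)]
    have h3 : I * S.indicator u x ≤ Φ (U x) * u x := by
      by_cases hxS : x ∈ S
      · rw [indicator_of_mem hxS, hΦI _ hxS.2]
      · rw [indicator_of_notMem hxS, mul_zero]
        exact mul_nonneg (hΦ0 _) (hu_nonneg x hx)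
    rw [hL]
    have h4 := mul_le_mul_of_nonneg_right (add_le_add h2 h1) (hu_nonneg x hx)
    have h5 := mul_le_mul_of_nonneg_left h3 hγ
    linarith
  have hmono := setIntegral_mono_on hLi (hψHi.sub (hSi.const_mul (γ * I))) hU𝒰 hpt
  rw [hzero, integral_sub' hψHi (hSi.const_mul _), integral_const_mul,
    setIntegral_indicator hSm, inter_eq_self_of_subset_right (sep_subset _ _)] at hmono
  linarith

/-- Exponential decay of the law of `U` truncated at a level `r` where `U ≤ r'` is compact. -/
lemma measureReal_lawOf_Icc_mul_exp_le (hUopen : IsOpen 𝒰)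
    (ha : ∀ i j, ContinuousOn (fun x => a x i j) 𝒰)
    (ha_psd : ∀ x ∈ 𝒰, ∀ v : Fin n → ℝ, 0 ≤ ∑ i, ∑ j, a x i j * v i * v j)
    (hV : ContinuousOn V 𝒰) (hu : ContinuousOn u 𝒰) (hu_nonneg : ∀ x ∈ 𝒰, 0 ≤ u x)
    (hu_int : IntegrableOn u 𝒰)
    (hu_stat : ∀ f : Eucl n → ℝ, ContDiff ℝ (⊤ : ℕ∞) f → HasCompactSupport f →
      tsupport f ⊆ 𝒰 → (∫ x in 𝒰, Lop a V f x * u x) = 0)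
    (hU_C2 : ContDiffOn ℝ 2 U 𝒰) {γ b c r r' B : ℝ} (hbc : b ≤ c) (hcr : c ≤ r) (hrr' : r < r')
    (hK : IsCompact {x ∈ 𝒰 | U x ≤ r'}) (hγ : 0 ≤ γ)
    (hLyap : ∀ x ∈ 𝒰, b < U x → Lop a V U x ≤ -γ)
    {H : ℝ → ℝ} (hH : Measurable H) (hH_pos : ∀ y ∈ Icc b c, 0 < H y)
    (hH_le : ∀ y ∈ Icc b c, H y ≤ B) (hH_up : ∀ x ∈ 𝒰, aQuad a U x ≤ H (U x))
    (hint : IntervalIntegrable (fun y => 1 / H y) volume b c) :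
    (lawOf 𝒰 u U).real (Icc c r) * Real.exp (γ * ∫ y in b..c, 1 / H y) ≤
      (lawOf 𝒰 u U).real (Icc b r) := by
  have := isFiniteMeasure_lawOf (U := U) hu_int
  have h𝒰 := hUopen.measurableSet
  have hUc := hU_C2.continuousOn
  rw [← intervalIntegral.integral_const_mul]
  refine mul_exp_integral_le_of_mul_one_add_le (G := fun t => (lawOf 𝒰 u U).real (Icc t r)) hbc
    (fun s _ t _ hst => measureReal_mono (Icc_subset_Icc_left hst)) (hint.const_mul γ)
    (intervalIntegral.integral_nonneg hbc fun y hy =>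
      mul_nonneg hγ (one_div_pos.2 (hH_pos y hy)).le) fun s hs t ht hst => ?_
  have hsub : Ioo s t ⊆ Icc b c := fun y hy => ⟨hs.1.trans hy.1.le, hy.2.le.trans ht.2⟩
  have htr : t ≤ r := ht.2.trans hcr
  have hkey : γ * (lawOf 𝒰 u U).real (Icc t r) * ∫ y in s..t, 1 / H y ≤
      (lawOf 𝒰 u U).real (Ioo s t) := by
    refine mul_integral_one_div_le_measureReal_Ioo (B := B) hst
      (mul_nonneg hγ measureReal_nonneg) hH (fun y hy => hH_pos y (hsub hy))
      (fun y hy => hH_le y (hsub hy))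
      (hint.mono_set (by rw [uIcc_of_le hbc]; exact uIcc_subset_Icc hs ht)) ?_
    intro ψ hψ hψ0 hψ1 hψs
    rw [integral_lawOf h𝒰 hUc hu hu_nonneg (k := fun y => ψ y * H y) (hψ.measurable.mul hH),
      measureReal_lawOf h𝒰 hUc hu hu_nonneg measurableSet_Icc]
    exact mul_integral_mul_mass_le hUopen ha ha_psd hV hu hu_nonneg hu_int hu_stat hU_C2 hst htr
      hrr' hK hγ (fun x hx hsx => hLyap x hx (hs.1.trans_lt hsx)) hH
      (fun y hy => (hH_pos y (hsub hy)).le) (fun y hy => hH_le y (hsub hy)) hH_up hψ hψ0 hψ1 hψs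
  have hdisj : Disjoint (Ioo s t) (Icc t r) :=
    disjoint_left.2 fun y hy hy' => absurd hy'.1 (not_le.2 hy.2)
  have hunion : (lawOf 𝒰 u U).real (Ioo s t) + (lawOf 𝒰 u U).real (Icc t r) ≤
      (lawOf 𝒰 u U).real (Icc s r) := by
    rw [← measureReal_union hdisj measurableSet_Icc]
    exact measureReal_mono (union_subset (fun y hy => ⟨hy.1.le, hy.2.le.trans htr⟩)
      (Icc_subset_Icc_left hst.le))
  rw [intervalIntegral.integral_const_mul]
  linarith

end Decay

/-- Estimate (yeta1): single-interval exponential decay in the proof of Theorem A(b). -/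
theorem estimate_yeta1
    {n : ℕ} (hn : 0 < n)
    (𝒰 : Set (Eucl n)) (hUopen : IsOpen 𝒰) (hUconn : IsConnected 𝒰)
    (a : Eucl n → Matrix (Fin n) (Fin n) ℝ)
    (ha_C1 : ∀ i j, ContDiffOn ℝ 1 (fun x => a x i j) 𝒰)
    (ha_symm : ∀ x ∈ 𝒰, ∀ i j, a x i j = a x j i)
    (ha_psd : ∀ x ∈ 𝒰, ∀ v : Fin n → ℝ, 0 ≤ ∑ i, ∑ j, a x i j * v i * v j)
    (V : Eucl n → Fin n → ℝ) (hV_cont : ContinuousOn V 𝒰)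
    (u : Eucl n → ℝ) (hu_C1 : ContDiffOn ℝ 1 u 𝒰) (hu_nonneg : ∀ x ∈ 𝒰, 0 ≤ u x)
    (hu_mass : (∫ x in 𝒰, u x) = 1)
    (hu_stat : ∀ f : Eucl n → ℝ, ContDiff ℝ (⊤ : ℕ∞) f → HasCompactSupport f →
      tsupport f ⊆ 𝒰 → (∫ x in 𝒰, Lop a V f x * u x) = 0)
    (U : Eucl n → ℝ) (ρM : EReal) (hU_C2 : ContDiffOn ℝ 2 U 𝒰)
    (hU_nonneg : ∀ x ∈ 𝒰, 0 ≤ U x)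
    (hU_lt : ∀ x ∈ 𝒰, (U x : EReal) < ρM)
    (hU_sup : ρM = ⨆ x : 𝒰, (U x.1 : EReal))
    (hU_cpt : ∀ ρ : ℝ, (ρ : EReal) < ρM → IsCompact {x ∈ 𝒰 | U x ≤ ρ})
    (ρm γ : ℝ) (hρm_pos : 0 < ρm) (hρm_lt : (ρm : EReal) < ρM) (hγ : 0 < γ)
    (hLyap : ∀ x ∈ 𝒰, x ∉ closure {y ∈ 𝒰 | U y < ρm} → Lop a V U x ≤ -γ)
    (H : ℝ → ℝ) (hH_meas : Measurable H)
    (hH_nonneg : ∀ t : ℝ, 0 ≤ t → (t : EReal) < ρM → 0 ≤ H t)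
    (hH_locbdd : ∀ ρ : ℝ, (ρ : EReal) < ρM → BddAbove (H '' Set.Icc 0 ρ))
    (hH_up : ∀ x ∈ 𝒰, aQuad a U x ≤ H (U x))
    (hH_pos : ∀ t : ℝ, ρm ≤ t → (t : EReal) < ρM → 0 < H t)
    (hR : ∀ᵐ r ∂(volume.restrict {t : ℝ | ρm ≤ t ∧ (t : EReal) < ρM}),
      ∀ x ∈ 𝒰, U x = r → gradient U x ≠ 0)
    (ηt η : ℝ) (hη1 : ρm ≤ ηt) (hη2 : ηt ≤ η) (hη3 : (η : EReal) < ρM)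
    (hreg : ∀ r ∈ Set.Ioo ηt η, ∀ x ∈ 𝒰, U x = r → gradient U x ≠ 0) :
    (∫ x in {x ∈ 𝒰 | η ≤ U x}, u x) ≤
      (∫ x in {x ∈ 𝒰 | ηt ≤ U x}, u x) * Real.exp (-γ * ∫ t in ηt..η, 1 / H t) := by
  have h𝒰 := hUopen.measurableSet
  have hUc := hU_C2.continuousOn
  have hu_int : IntegrableOn u 𝒰 := Integrable.of_integral_ne_zero (by rw [hu_mass]; norm_num)
  have hmono : ∀ E : Set (Eucl n), ∀ b : ℝ, E ⊆ {x ∈ 𝒰 | b ≤ U x} →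
      (∫ x in E, u x) ≤ ∫ x in {x ∈ 𝒰 | b ≤ U x}, u x := fun E b hE =>
    setIntegral_mono_set (hu_int.mono_set (Set.sep_subset _ _))
      ((ae_restrict_iff' (measurableSet_sep_preimage h𝒰 hUc measurableSet_Ici)).2
        (Filter.Eventually.of_forall fun x hx => hu_nonneg x hx.1)) hE.eventuallyLE
  by_cases hint : IntervalIntegrable (fun t => 1 / H t) volume ηt η
  swap
  · rw [intervalIntegral.integral_undef hint, mul_zero, Real.exp_zero, mul_one]
    exact hmono _ _ fun x hx => ⟨hx.1, hη2.trans hx.2⟩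
  have hltρM : ∀ {y : ℝ}, y ≤ η → (y : EReal) < ρM := fun hy =>
    (EReal.coe_le_coe_iff.2 hy).trans_lt hη3
  obtain ⟨B, hB⟩ := hH_locbdd η hη3
  have hLyap' : ∀ x ∈ 𝒰, ηt < U x → Lop a V U x ≤ -γ := by
    refine fun x hx hxU => hLyap x hx fun hcl => ?_
    obtain ⟨y, hyU, hy⟩ := mem_closure_iff.1 hcl _
      (hUc.isOpen_inter_preimage hUopen (isOpen_Ioi (a := ηt))) ⟨hx, hxU⟩
    exact absurd (hη1.trans_lt hyU.2) (not_lt.2 hy.2.le)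
  have htrunc : ∀ r : ℝ, η ≤ r → (r : EReal) < ρM →
      (∫ x in {x ∈ 𝒰 | U x ∈ Set.Icc η r}, u x) * Real.exp (γ * ∫ t in ηt..η, 1 / H t) ≤
        ∫ x in {x ∈ 𝒰 | ηt ≤ U x}, u x := by
    intro r hηr hr
    obtain ⟨r', hrr', hr'⟩ := EReal.lt_iff_exists_real_btwn.1 hr
    have h := measureReal_lawOf_Icc_mul_exp_le hUopen (fun i j => (ha_C1 i j).continuousOn) ha_psd
      hV_cont hu_C1.continuousOn hu_nonneg hu_int hu_stat hU_C2 hη2 hηr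
      (EReal.coe_lt_coe_iff.1 hrr') (hU_cpt r' hr') hγ.le hLyap' hH_meas
      (fun y hy => hH_pos y (hη1.trans hy.1) (hltρM hy.2))
      (fun y hy => hB ⟨y, ⟨hρm_pos.le.trans (hη1.trans hy.1), hy.2⟩, rfl⟩) hH_up hint
    rw [measureReal_lawOf h𝒰 hUc hu_C1.continuousOn hu_nonneg measurableSet_Icc,
      measureReal_lawOf h𝒰 hUc hu_C1.continuousOn hu_nonneg measurableSet_Icc] at h
    exact h.trans (hmono _ _ fun x hx => ⟨hx.1, hx.2.1⟩)
  obtain ⟨y, hy_mono, hy_mem, hy_lim⟩ := exists_seq_strictMono_tendsto' hη3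
  have hy_coe : ∀ k, ((y k).toReal : EReal) = y k := fun k =>
    EReal.coe_toReal (hy_mem k).2.ne_top (hy_mem k).1.ne_bot
  have hS : (⋃ k, {x ∈ 𝒰 | U x ∈ Set.Icc η (y k).toReal}) = {x ∈ 𝒰 | η ≤ U x} := by
    refine Set.Subset.antisymm (Set.iUnion_subset fun k x hx => ⟨hx.1, hx.2.1⟩) fun x hx => ?_
    obtain ⟨k, hk⟩ := (hy_lim.eventually_const_lt (hU_lt x hx.1)).exists
    refine Set.mem_iUnion.2 ⟨k, hx.1, hx.2, ?_⟩
    rw [← hy_coe k] at hk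
    exact (EReal.coe_lt_coe_iff.1 hk).le
  have hlim : Filter.Tendsto (fun k => ∫ x in {x ∈ 𝒰 | U x ∈ Set.Icc η (y k).toReal}, u x)
      Filter.atTop (nhds (∫ x in {x ∈ 𝒰 | η ≤ U x}, u x)) := by
    rw [← hS]
    refine tendsto_setIntegral_of_monotone
      (fun k => measurableSet_sep_preimage h𝒰 hUc measurableSet_Icc) (fun i j hij x hx => ?_) ?_
    · refine ⟨hx.1, hx.2.1, hx.2.2.trans ?_⟩
      rw [← EReal.coe_le_coe_iff, hy_coe, hy_coe]
      exact hy_mono.monotone hij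
    · rw [hS]
      exact hu_int.mono_set (Set.sep_subset _ _)
  rw [neg_mul, Real.exp_neg, ← div_eq_mul_inv, le_div_iff₀ (Real.exp_pos _)]
  refine le_of_tendsto (hlim.mul_const _) (Filter.Eventually.of_forall fun k => htrunc _ ?_ ?_)
  · rw [← EReal.coe_le_coe_iff, hy_coe]
    exact (hy_mem k).1.le
  · rw [hy_coe]
    exact (hy_mem k).2
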